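/- Let a, b, c ∈ [−1, 1] and let V : S² → S² be the Volterra quadratic stochastic operator V(x, y, z) = (x(1 + a·y − b·z), y(1 − a·x + c·z), z(1 + b·x − c·y)). Then V is non-ergodic (i.e. there exists an initial point w ∈ S² for which the Cesàro averages (1/k)·Σ_{i=0}^{k−1} V^i w do not converge as k → ∞) if and only if the three parameters a, b, c have the same sign, i.e. either a > 0, b > 0, c > 0 or a < 0, b < 0, c < 0. -/

import Mathlib

open Filter

/-- The Volterra quadratic stochastic operator on `ℝ³` with parameters `a, b, c`:
`V(x, y, z) = (x(1 + a·y − b·z), y(1 − a·x + c·z), z(1 + b·x − c·y))`. -/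
def volterra (a b c : ℝ) : ℝ × ℝ × ℝ → ℝ × ℝ × ℝ :=
  fun w => (w.1 * (1 + a * w.2.1 - b * w.2.2),
            w.2.1 * (1 - a * w.1 + c * w.2.2),
            w.2.2 * (1 + b * w.1 - c * w.2.1))

/-- The 2-dimensional simplex `S² = {(x,y,z) : x, y, z ≥ 0, x + y + z = 1}`. -/
def simplex2 : Set (ℝ × ℝ × ℝ) :=
  {w | 0 ≤ w.1 ∧ 0 ≤ w.2.1 ∧ 0 ≤ w.2.2 ∧ w.1 + w.2.1 + w.2.2 = 1}

open Topology in
/-- The Cesàro averages of the real sequence `u` converge to `l`. -/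
def HasMean (u : ℕ → ℝ) (l : ℝ) : Prop :=
  Tendsto (fun n : ℕ => (n : ℝ)⁻¹ * ∑ i ∈ Finset.range n, u i) atTop (𝓝 l)

namespace HasMean

variable {u v : ℕ → ℝ} {l m : ℝ}

theorem add (hu : HasMean u l) (hv : HasMean v m) : HasMean (fun n => u n + v n) (l + m) := by
  refine (Tendsto.add hu hv).congr fun n => ?_
  rw [Finset.sum_add_distrib, mul_add]

theorem const_mul (r : ℝ) (hu : HasMean u l) : HasMean (fun n => r * u n) (r * l) := by
  refine (Tendsto.const_mul r hu).congr fun n => ?_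
  rw [← Finset.mul_sum]
  ring

theorem congr (hu : HasMean u l) (h : ∀ n, u n = v n) (hl : l = m) : HasMean v m := by
  obtain rfl : u = v := funext h
  exact hl ▸ hu

theorem nonneg (hu : HasMean u l) (h : ∀ n, 0 ≤ u n) : 0 ≤ l :=
  ge_of_tendsto' hu fun n =>
    mul_nonneg (by positivity) (Finset.sum_nonneg fun i _ => h i)

/-- A nonnegative sequence dominated by a sequence of mean zero has mean zero. -/
theorem squeeze_zero (hv : HasMean v 0) (h0 : ∀ n, 0 ≤ u n) (h : ∀ n, u n ≤ v n) :
    HasMean u 0 :=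
  _root_.squeeze_zero (fun n => mul_nonneg (by positivity) (Finset.sum_nonneg fun i _ => h0 i))
    (fun n => mul_le_mul_of_nonneg_left (Finset.sum_le_sum fun i _ => h i) (by positivity)) hv

/-- A sequence in `[0, 1]` whose sums over late blocks are bounded independently of the length
of the block has mean zero. -/
theorem zero_of_block_sum_le {C : ℝ} (h0 : ∀ n, 0 ≤ u n) (h1 : ∀ n, u n ≤ 1)
    (hC : ∀ N : ℕ, ∀ᶠ n in atTop, ∑ i ∈ Finset.range N, u (n + i) ≤ C) : HasMean u 0 := by
  have hC0 : 0 ≤ C := by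
    obtain ⟨n, hn⟩ := (hC 0).exists
    simpa using hn
  have bound : ∀ N : ℕ, 0 < N → ∃ K : ℝ, ∀ n : ℕ,
      ∑ i ∈ Finset.range n, u i ≤ K + C / N * n := by
    intro N hN
    obtain ⟨n₀, hn₀⟩ := eventually_atTop.1 (hC N)
    refine ⟨(n₀ + N : ℕ), fun n => ?_⟩
    have hN' : (0 : ℝ) < N := by exact_mod_cast hN
    induction n using Nat.strong_induction_on with
    | _ n ih =>
      rcases le_total n (n₀ + N) with hn | hn
      · have h : ∑ i ∈ Finset.range n, u i ≤ n := by
          simpa using Finset.sum_le_sum fun i (_ : i ∈ Finset.range n) => h1 i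
        have h' : (n : ℝ) ≤ (n₀ + N : ℕ) := by exact_mod_cast hn
        have : 0 ≤ C / N * n := by positivity
        linarith
      · obtain ⟨k, rfl⟩ : ∃ k, n = k + N := ⟨n - N, by omega⟩
        rw [Finset.sum_range_add]
        have h2 := ih k (by omega)
        have h3 := hn₀ k (by omega)
        have h4 : C / N * ((k + N : ℕ) : ℝ) = C / N * k + C := by
          push_cast
          field_simp
        linarith
  rw [HasMean, Metric.tendsto_atTop]
  intro ε hε
  obtain ⟨N, hN⟩ := exists_nat_gt (2 * C / ε)
  have hN' : (0 : ℝ) < N := lt_of_le_of_lt (by positivity) hN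
  obtain ⟨K, hK⟩ := bound N (by exact_mod_cast hN')
  obtain ⟨M, hM⟩ := exists_nat_gt (2 * K / ε)
  refine ⟨M + 1, fun n hn => ?_⟩
  have hn0 : (0 : ℝ) < n := by
    have : 0 < n := by omega
    exact_mod_cast this
  have hMn : (M : ℝ) ≤ n := by
    have : M ≤ n := by omega
    exact_mod_cast this
  have hS : 0 ≤ ∑ i ∈ Finset.range n, u i := Finset.sum_nonneg fun i _ => h0 i
  rw [Real.dist_eq, sub_zero, abs_of_nonneg (by positivity), inv_mul_lt_iff₀ hn0]
  have h2 : C / N < ε / 2 := by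
    rw [div_lt_iff₀ hε] at hN
    rw [div_lt_iff₀ hN']
    linarith
  have h3 : K < ε / 2 * n := by
    rw [div_lt_iff₀ hε] at hM
    nlinarith
  have h4 : C / N * n < ε / 2 * n := mul_lt_mul_of_pos_right h2 hn0
  linarith [hK n]

end HasMean

theorem Real.one_add_le_exp_sub_sq_div_six {t : ℝ} (h0 : -1 ≤ t) (h1 : t ≤ 1) :
    1 + t ≤ Real.exp (t - t ^ 2 / 6) := by
  obtain ⟨s, hs0, hs⟩ : ∃ s, 0 ≤ s ∧ s ^ 2 = 1 + t :=
    ⟨√(1 + t), Real.sqrt_nonneg _, Real.sq_sqrt (by linarith)⟩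
  obtain rfl : t = s ^ 2 - 1 := by linarith
  have hs1 : s ≤ 3 / 2 := by nlinarith
  have h2 : 2 * (s - 1) ≤ s ^ 2 - 1 - (s ^ 2 - 1) ^ 2 / 6 := by
    nlinarith [mul_nonneg (sq_nonneg (s - 1)) (show 0 ≤ 5 - 2 * s - s ^ 2 by nlinarith)]
  calc 1 + (s ^ 2 - 1) = s ^ 2 := by ring
    _ ≤ Real.exp (s - 1) ^ 2 := by
      gcongr
      linarith [Real.add_one_le_exp (s - 1)]
    _ = Real.exp (2 * (s - 1)) := by
      rw [← Real.exp_nat_mul]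
      norm_num
    _ ≤ _ := Real.exp_le_exp.2 h2

/-- A positive sequence with growth rates `1 + t n`, where `t - t ^ 2 / 6` has negative mean, is
summable. -/
theorem summable_of_growth_hasMean_neg {u t : ℕ → ℝ} {g : ℝ} (hu : ∀ n, 0 < u n)
    (hrec : ∀ n, u (n + 1) = u n * (1 + t n)) (h0 : ∀ n, -1 ≤ t n) (h1 : ∀ n, t n ≤ 1)
    (hm : HasMean (fun n => t n - t n ^ 2 / 6) g) (hg : g < 0) : Summable u := by
  have hexp : ∀ n, u n ≤ u 0 * Real.exp (∑ i ∈ Finset.range n, (t i - t i ^ 2 / 6)) := by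
    intro n
    induction n with
    | zero => simp
    | succ n ih =>
      rw [hrec, Finset.sum_range_succ, Real.exp_add, ← mul_assoc]
      exact mul_le_mul ih (Real.one_add_le_exp_sub_sq_div_six (h0 n) (h1 n))
        (by linarith [h0 n]) ((hu n).le.trans ih)
  have hsum : Summable fun n : ℕ => u 0 * Real.exp (g / 2) ^ n :=
    (summable_geometric_of_lt_one (Real.exp_pos _).le (Real.exp_lt_one_iff.2 (by linarith))).mul_left _
  refine Summable.of_norm_bounded_eventually_nat hsum ?_
  filter_upwards [hm.eventually_lt_const (show g < g / 2 by linarith), eventually_gt_atTop 0]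
    with n hn hn0
  have hn0' : (0 : ℝ) < n := by exact_mod_cast hn0
  rw [inv_mul_lt_iff₀ hn0'] at hn
  rw [Real.norm_of_nonneg (hu n).le, ← Real.exp_nat_mul]
  exact (hexp n).trans (mul_le_mul_of_nonneg_left (Real.exp_le_exp.2 hn.le) (hu 0).le)

/-- The coordinates of an orbit of `volterra a b c` in the interior of the simplex, for
`a, b, c ∈ (0, 1]`. -/
structure IsInteriorOrbit (a b c : ℝ) (x y z : ℕ → ℝ) : Prop where
  a_pos : 0 < a
  b_pos : 0 < b
  c_pos : 0 < c
  a_le : a ≤ 1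
  b_le : b ≤ 1
  c_le : c ≤ 1
  x_pos : ∀ n, 0 < x n
  y_pos : ∀ n, 0 < y n
  z_pos : ∀ n, 0 < z n
  sum_eq : ∀ n, x n + y n + z n = 1
  x_succ : ∀ n, x (n + 1) = x n * (1 + a * y n - b * z n)
  y_succ : ∀ n, y (n + 1) = y n * (1 - a * x n + c * z n)
  z_succ : ∀ n, z (n + 1) = z n * (1 + b * x n - c * y n)

namespace IsInteriorOrbit

open Topology

variable {a b c : ℝ} {x y z : ℕ → ℝ}

theorem rotate (h : IsInteriorOrbit a b c x y z) : IsInteriorOrbit c a b y z x where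
  a_pos := h.c_pos
  b_pos := h.a_pos
  c_pos := h.b_pos
  a_le := h.c_le
  b_le := h.a_le
  c_le := h.b_le
  x_pos := h.y_pos
  y_pos := h.z_pos
  z_pos := h.x_pos
  sum_eq n := by linarith [h.sum_eq n]
  x_succ n := by rw [h.y_succ]; ring
  y_succ n := by rw [h.z_succ]; ring
  z_succ n := by rw [h.x_succ]

theorem growth_mem (h : IsInteriorOrbit a b c x y z) (n : ℕ) :
    -1 < a * y n - b * z n ∧ a * y n - b * z n ≤ 1 := by
  have := h.x_pos n
  have := h.sum_eq n
  have h1 := mul_le_of_le_one_left (h.y_pos n).le h.a_le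
  have h2 := mul_le_of_le_one_left (h.z_pos n).le h.b_le
  have h3 := mul_pos h.a_pos (h.y_pos n)
  have h4 := mul_pos h.b_pos (h.z_pos n)
  have := h.y_pos n
  have := h.z_pos n
  constructor <;> linarith

theorem not_summable (h : IsInteriorOrbit a b c x y z) : ¬ Summable x := by
  intro hx
  have hx0 := hx.tendsto_atTop_zero
  have hmono : Monotone fun n => y n + ∑ i ∈ Finset.range n, x i := by
    refine monotone_nat_of_le_succ fun n => ?_
    simp only [Finset.sum_range_succ]
    rw [h.y_succ]
    have h1 := mul_pos (h.y_pos n) (mul_pos h.c_pos (h.z_pos n))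
    have h2 : a * y n ≤ 1 := by
      have := h.x_pos n
      have := h.z_pos n
      exact mul_le_one₀ h.a_le (h.y_pos n).le (by linarith [h.sum_eq n])
    nlinarith [h.x_pos n]
  have hbdd : BddAbove (Set.range fun n => y n + ∑ i ∈ Finset.range n, x i) := by
    refine ⟨1 + ∑' i, x i, ?_⟩
    rintro _ ⟨n, rfl⟩
    have h1 := hx.sum_le_tsum (Finset.range n) fun i _ => (h.x_pos i).le
    have := h.x_pos n
    have := h.z_pos n
    have := h.sum_eq n
    dsimp only
    linarith
  obtain ⟨Y, hY⟩ : ∃ Y, Tendsto y atTop (𝓝 Y) := by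
    refine ⟨_, ((tendsto_atTop_ciSup hmono hbdd).sub hx.hasSum.tendsto_sum_nat).congr fun n => ?_⟩
    ring
  have hZ : Tendsto z atTop (𝓝 (1 - Y)) := by
    have := (hY.const_sub 1).sub hx0
    rw [sub_zero] at this
    exact this.congr fun n => by linarith [h.sum_eq n]
  have hfix : Y = Y * (1 - a * 0 + c * (1 - Y)) := by
    refine tendsto_nhds_unique ((tendsto_add_atTop_iff_nat 1).2 hY) ?_
    refine (hY.mul (((hx0.const_mul a).const_sub 1).add (hZ.const_mul c))).congr fun n => ?_
    exact (h.y_succ n).symm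
  have key : ∀ u r : ℕ → ℝ, (∀ n, 0 < u n) → (∀ n, u (n + 1) = u n * r n) →
      Tendsto u atTop (𝓝 0) → ∀ l > 1, ¬ Tendsto r atTop (𝓝 l) := by
    intro u r hu hur hu0 l hl hr
    obtain ⟨n₀, hn₀⟩ := eventually_atTop.1 (hr.eventually_const_lt hl)
    have hge : ∀ n ≥ n₀, u n₀ ≤ u n := by
      intro n hn
      induction n, hn using Nat.le_induction with
      | base => exact le_rfl
      | succ n hn ih =>
        rw [hur]
        exact ih.trans (le_mul_of_one_le_right (hu n).le (hn₀ n hn).le)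
    exact absurd (ge_of_tendsto hu0 (eventually_atTop.2 ⟨n₀, hge⟩)) (not_le.2 (hu n₀))
  have hYZ : Y = 0 ∨ Y = 1 := by
    have : Y * (c * (1 - Y)) = 0 := by linarith
    rcases mul_eq_zero.1 this with h1 | h1
    · exact Or.inl h1
    · have := (mul_eq_zero.1 h1).resolve_left h.c_pos.ne'
      exact Or.inr (by linarith)
  rcases hYZ with rfl | rfl
  · exact key y _ h.y_pos h.y_succ hY (1 - a * 0 + c * (1 - 0)) (by linarith [h.c_pos])
      (((hx0.const_mul a).const_sub 1).add (hZ.const_mul c))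
  · exact key x _ h.x_pos h.x_succ hx0 (1 + a * 1 - b * (1 - 1)) (by linarith [h.a_pos])
      (((hY.const_mul a).const_add 1).sub (hZ.const_mul b))

/-- If the third coordinate is small at some time, then the following sum of a block of values of
`x y + y z + z x` is bounded independently of its length. -/
theorem block_sum_le (h : IsInteriorOrbit a b c x y z) (N : ℕ) : ∃ η > 0, ∀ n, z n ≤ η →
    ∑ i ∈ Finset.range N,
      (x (n + i) * y (n + i) + y (n + i) * z (n + i) + z (n + i) * x (n + i)) ≤ 2 / a := by
  refine ⟨1 / (2 * (N + 1) * 2 ^ N), by positivity, fun n hn => ?_⟩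
  have hz : ∀ i, z (n + i) ≤ 2 ^ i * z n := by
    intro i
    induction i with
    | zero => simp
    | succ i ih =>
      have h1 := h.rotate.rotate.growth_mem (n + i)
      rw [← add_assoc, h.z_succ, pow_succ]
      nlinarith [h.z_pos (n + i)]
  have hz' : ∀ i ∈ Finset.range N, 2 * z (n + i) ≤ 1 / (N + 1) := by
    intro i hi
    have h1 : (2 : ℝ) ^ i ≤ 2 ^ N :=
      pow_le_pow_right₀ (by norm_num) (Finset.mem_range.1 hi).le
    calc 2 * z (n + i) ≤ 2 * (2 ^ N * (1 / (2 * (N + 1) * 2 ^ N))) := by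
          have := hz i
          have : (2 : ℝ) ^ i * z n ≤ 2 ^ N * (1 / (2 * (N + 1) * 2 ^ N)) :=
            mul_le_mul h1 hn (h.z_pos n).le (by positivity)
          linarith
      _ = 1 / (N + 1) := by field_simp
  have hterm : ∀ i ∈ Finset.range N,
      a * (x (n + i) * y (n + i) + y (n + i) * z (n + i) + z (n + i) * x (n + i)) ≤
        (x (n + (i + 1)) - x (n + i)) + 1 / (N + 1) := by
    intro i hi
    refine le_trans ?_ (add_le_add le_rfl (hz' i hi))
    rw [← add_assoc, h.x_succ]
    have hx := h.x_pos (n + i)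
    have hy := h.y_pos (n + i)
    have hz := h.z_pos (n + i)
    have hs := h.sum_eq (n + i)
    have h1 : a * (z (n + i) * (x (n + i) + y (n + i))) ≤ z (n + i) := by
      have : z (n + i) * (x (n + i) + y (n + i)) ≤ z (n + i) := by nlinarith
      have : 0 ≤ z (n + i) * (x (n + i) + y (n + i)) := by positivity
      nlinarith [h.a_le]
    have h2 : b * (z (n + i) * x (n + i)) ≤ z (n + i) := by
      have : z (n + i) * x (n + i) ≤ z (n + i) := by nlinarith
      have : 0 ≤ z (n + i) * x (n + i) := by positivity
      nlinarith [h.b_le]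
    nlinarith
  rw [le_div_iff₀ h.a_pos, mul_comm, Finset.mul_sum]
  refine (Finset.sum_le_sum hterm).trans ?_
  rw [Finset.sum_add_distrib, Finset.sum_range_sub (fun i => x (n + i))]
  have h1 : ∑ i ∈ Finset.range N, (1 : ℝ) / (N + 1) ≤ 1 := by
    rw [Finset.sum_const, Finset.card_range, nsmul_eq_mul, mul_one_div,
      div_le_one (by positivity)]
    linarith
  have := h.x_pos (n + 0)
  have := h.y_pos (n + N)
  have := h.z_pos (n + N)
  have := h.sum_eq (n + N)
  linarith

/-- If the orbit approaches the boundary then `x y + y z + z x` has mean zero. -/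
theorem hasMean_prod_zero (h : IsInteriorOrbit a b c x y z)
    (hb : ∀ η > 0, ∀ᶠ n in atTop, x n ≤ η ∨ y n ≤ η ∨ z n ≤ η) :
    HasMean (fun n => x n * y n + y n * z n + z n * x n) 0 := by
  have ha := h.a_pos
  have hb' := h.b_pos
  have hc := h.c_pos
  refine HasMean.zero_of_block_sum_le (C := 2 / a + 2 / b + 2 / c) (fun n => ?_) (fun n => ?_)
    fun N => ?_
  · have := h.x_pos n
    have := h.y_pos n
    have := h.z_pos n
    positivity
  · have := h.x_pos n
    have := h.y_pos n
    have := h.z_pos n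
    have := h.sum_eq n
    nlinarith
  · obtain ⟨η₁, h₁, H₁⟩ := h.block_sum_le N
    obtain ⟨η₂, h₂, H₂⟩ := h.rotate.block_sum_le N
    obtain ⟨η₃, h₃, H₃⟩ := h.rotate.rotate.block_sum_le N
    have : 0 < 2 / a := by positivity
    have : 0 < 2 / b := by positivity
    have : 0 < 2 / c := by positivity
    filter_upwards [hb (min η₁ (min η₂ η₃)) (by positivity)] with n hn
    rcases hn with hn | hn | hn
    · have := H₂ n (hn.trans ((min_le_right _ _).trans (min_le_left _ _)))
      calc _ = _ := Finset.sum_congr rfl fun i _ => by ring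
        _ ≤ _ := this
        _ ≤ _ := by linarith
    · have := H₃ n (hn.trans ((min_le_right _ _).trans (min_le_right _ _)))
      calc _ = _ := Finset.sum_congr rfl fun i _ => by ring
        _ ≤ _ := this
        _ ≤ _ := by linarith
    · have := H₁ n (hn.trans (min_le_left _ _))
      linarith

theorem log_succ_le (h : IsInteriorOrbit a b c x y z) (n : ℕ) :
    Real.log (x (n + 1)) ≤
      Real.log (x n) + (a * y n - b * z n) - (a * y n - b * z n) ^ 2 / 6 := by
  obtain ⟨h0, h1⟩ := h.growth_mem n
  have h2 : 0 < 1 + (a * y n - b * z n) := by linarith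
  rw [h.x_succ, add_sub_assoc, Real.log_mul (h.x_pos n).ne' h2.ne']
  have := (Real.log_le_iff_le_exp h2).2 (Real.one_add_le_exp_sub_sq_div_six h0.le h1)
  linarith

/-- The orbit of a point where the Lyapunov function `c log x + b log y + a log z` is smaller than
at the interior fixed point approaches the boundary. -/
theorem eventually_le_of_lyapunov_lt (h : IsInteriorOrbit a b c x y z)
    (h0 : c * Real.log (x 0) + b * Real.log (y 0) + a * Real.log (z 0) <
      c * Real.log (c / (a + b + c)) + b * Real.log (b / (a + b + c)) +
        a * Real.log (a / (a + b + c))) :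
    ∀ η > 0, ∀ᶠ n in atTop, x n ≤ η ∨ y n ≤ η ∨ z n ≤ η := by
  have ha := h.a_pos
  have hb := h.b_pos
  have hc := h.c_pos
  have hs : 0 < a + b + c := by positivity
  set Φ : ℕ → ℝ := fun n => c * Real.log (x n) + b * Real.log (y n) + a * Real.log (z n) with hΦ
  set D : ℕ → ℝ := fun n => (c * (a * y n - b * z n) ^ 2 + b * (c * z n - a * x n) ^ 2 +
    a * (b * x n - c * y n) ^ 2) / 6 with hD
  have hstep : ∀ n, D n ≤ Φ n - Φ (n + 1) := by
    intro n
    have h1 := mul_le_mul_of_nonneg_left (h.log_succ_le n) hc.le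
    have h2 := mul_le_mul_of_nonneg_left (h.rotate.log_succ_le n) hb.le
    have h3 := mul_le_mul_of_nonneg_left (h.rotate.rotate.log_succ_le n) ha.le
    simp only [hΦ, hD]
    linarith
  have hD0 : ∀ n, 0 ≤ D n := fun n => by positivity
  have hanti : Antitone Φ := antitone_nat_of_succ_le fun n => by linarith [hstep n, hD0 n]
  rcases tendsto_atTop_of_antitone hanti with hlim | ⟨l, hl⟩
  · intro η hη
    filter_upwards [hlim.eventually_lt_atBot ((a + b + c) * Real.log η)] with n hn
    by_contra! hcon
    obtain ⟨hx, hy, hz⟩ := hcon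
    have h1 := mul_lt_mul_of_pos_left (Real.log_lt_log hη hx) hc
    have h2 := mul_lt_mul_of_pos_left (Real.log_lt_log hη hy) hb
    have h3 := mul_lt_mul_of_pos_left (Real.log_lt_log hη hz) ha
    simp only [hΦ] at hn
    linarith
  · exfalso
    have hD' : Tendsto D atTop (𝓝 0) := by
      refine squeeze_zero hD0 hstep ?_
      simpa using hl.sub ((tendsto_add_atTop_iff_nat 1).2 hl)
    have hsq : ∀ (r : ℝ) (t : ℕ → ℝ), 0 < r → (∀ n, r * t n ^ 2 / 6 ≤ D n) →
        Tendsto t atTop (𝓝 0) := by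
      intro r t hr ht
      have h1 : Tendsto (fun n => t n ^ 2) atTop (𝓝 0) := by
        refine squeeze_zero (fun n => sq_nonneg _) (fun n => ?_)
          (by simpa using hD'.const_mul (6 / r))
        have := ht n
        rw [div_mul_eq_mul_div, le_div_iff₀ hr]
        linarith
      have h2 := h1.sqrt
      simp only [Real.sqrt_sq_eq_abs, Real.sqrt_zero] at h2
      exact (tendsto_zero_iff_abs_tendsto_zero _).2 h2
    have p1 : ∀ n, 0 ≤ c * (a * y n - b * z n) ^ 2 := fun n => by positivity
    have p2 : ∀ n, 0 ≤ b * (c * z n - a * x n) ^ 2 := fun n => by positivity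
    have p3 : ∀ n, 0 ≤ a * (b * x n - c * y n) ^ 2 := fun n => by positivity
    have t1 := hsq c (fun n => a * y n - b * z n) hc fun n => by
      simp only [hD]; linarith [p1 n, p2 n, p3 n]
    have t2 := hsq b (fun n => c * z n - a * x n) hb fun n => by
      simp only [hD]; linarith [p1 n, p2 n, p3 n]
    have t3 := hsq a (fun n => b * x n - c * y n) ha fun n => by
      simp only [hD]; linarith [p1 n, p2 n, p3 n]
    have lim : ∀ (w t t' : ℕ → ℝ) (r : ℝ), 0 < r → Tendsto t atTop (𝓝 0) →
        Tendsto t' atTop (𝓝 0) → (∀ n, (a + b + c) * w n = r + t n - t' n) →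
        Tendsto (fun n => Real.log (w n)) atTop (𝓝 (Real.log (r / (a + b + c)))) := by
      intro w t t' r hr ht ht' hw
      refine Tendsto.log ?_ (by positivity)
      have := ((ht.const_add r).sub ht').div_const (a + b + c)
      rw [add_zero, sub_zero] at this
      refine this.congr fun n => ?_
      rw [← hw, mul_div_cancel_left₀ _ hs.ne']
    have lx := lim x _ _ c hc t3 t2 fun n => by linear_combination c * h.sum_eq n
    have ly := lim y _ _ b hb t1 t3 fun n => by linear_combination b * h.sum_eq n
    have lz := lim z _ _ a ha t2 t1 fun n => by linear_combination a * h.sum_eq n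
    have hle := hanti.le_of_tendsto
      (((lx.const_mul c).add (ly.const_mul b)).add (lz.const_mul a)) 0
    exact absurd hle (not_le.2 h0)

theorem nonneg_of_hasMean (h : IsInteriorOrbit a b c x y z)
    (hq : HasMean (fun n => x n * y n + y n * z n + z n * x n) 0) {M N : ℝ}
    (hy : HasMean y M) (hz : HasMean z N) :
    0 ≤ a * M - b * N - (a ^ 2 * M + b ^ 2 * N) / 6 := by
  by_contra! hneg
  have hpos : ∀ n, 0 < x n * y n ∧ 0 < y n * z n ∧ 0 < z n * x n := fun n =>
    ⟨mul_pos (h.x_pos n) (h.y_pos n), mul_pos (h.y_pos n) (h.z_pos n),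
      mul_pos (h.z_pos n) (h.x_pos n)⟩
  have hxy : HasMean (fun n => x n * y n) 0 := hq.squeeze_zero (fun n => (hpos n).1.le)
    fun n => by linarith [(hpos n).2.1, (hpos n).2.2]
  have hyz : HasMean (fun n => y n * z n) 0 := hq.squeeze_zero (fun n => (hpos n).2.1.le)
    fun n => by linarith [(hpos n).1, (hpos n).2.2]
  have hzx : HasMean (fun n => z n * x n) 0 := hq.squeeze_zero (fun n => (hpos n).2.2.le)
    fun n => by linarith [(hpos n).1, (hpos n).2.1]
  refine h.not_summable (summable_of_growth_hasMean_neg (t := fun n => a * y n - b * z n)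
    h.x_pos (fun n => by rw [h.x_succ, add_sub_assoc]) (fun n => (h.growth_mem n).1.le)
    (fun n => (h.growth_mem n).2) ?_ hneg)
  refine ((((hy.const_mul (a - a ^ 2 / 6)).add (hz.const_mul (-b - b ^ 2 / 6))).add
    (hxy.const_mul (a ^ 2 / 6))).add ((hyz.const_mul ((a + b) ^ 2 / 6)).add
      (hzx.const_mul (b ^ 2 / 6)))).congr (fun n => ?_) (by ring)
  linear_combination (a ^ 2 * y n + b ^ 2 * z n) / 6 * h.sum_eq n

/-- The coordinates of an orbit that approaches the boundary do not all have a mean. -/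
theorem not_hasMean (h : IsInteriorOrbit a b c x y z)
    (hb : ∀ η > 0, ∀ᶠ n in atTop, x n ≤ η ∨ y n ≤ η ∨ z n ≤ η) {L M N : ℝ}
    (hx : HasMean x L) (hy : HasMean y M) (hz : HasMean z N) : False := by
  have hq := h.hasMean_prod_zero hb
  have h1 := h.nonneg_of_hasMean hq hy hz
  have h2 := h.rotate.nonneg_of_hasMean (hq.congr (fun n => by ring) rfl) hz hx
  have h3 := h.rotate.rotate.nonneg_of_hasMean (hq.congr (fun n => by ring) rfl) hx hy
  have hL := hx.nonneg fun n => (h.x_pos n).le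
  have hM := hy.nonneg fun n => (h.y_pos n).le
  have hN := hz.nonneg fun n => (h.z_pos n).le
  have hsum : L + M + N = 1 := by
    refine tendsto_nhds_unique ((hx.add hy).add hz) (tendsto_const_nhds.congr' ?_)
    filter_upwards [eventually_gt_atTop 0] with n hn
    rw [Finset.sum_congr rfl fun i _ => h.sum_eq i]
    have : (n : ℝ) ≠ 0 := by exact_mod_cast hn.ne'
    simp [this]
  have ha := h.a_pos
  have hb' := h.b_pos
  have hc := h.c_pos
  have h1' := mul_nonneg hc.le h1
  have h2' := mul_nonneg hb'.le h2
  have h3' := mul_nonneg ha.le h3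
  have hA : 0 < b * a ^ 2 + a * b ^ 2 := by positivity
  have hB : 0 < c * a ^ 2 + a * c ^ 2 := by positivity
  have hC : 0 < c * b ^ 2 + b * c ^ 2 := by positivity
  have hle : (b * a ^ 2 + a * b ^ 2) * L + (c * a ^ 2 + a * c ^ 2) * M +
      (c * b ^ 2 + b * c ^ 2) * N ≤ 0 := by nlinarith
  have hL' := mul_nonneg hA.le hL
  have hM' := mul_nonneg hB.le hM
  have hN' := mul_nonneg hC.le hN
  have hL0 : L = 0 := (mul_eq_zero.1 (by linarith)).resolve_left hA.ne'
  have hM0 : M = 0 := (mul_eq_zero.1 (by linarith)).resolve_left hB.ne'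
  have hN0 : N = 0 := (mul_eq_zero.1 (by linarith)).resolve_left hC.ne'
  linarith

end IsInteriorOrbit

/-- For `a, b, c ∈ (0, 1]` there is an interior starting point whose orbit has no mean. -/
theorem exists_start_not_hasMean {a b c : ℝ} (ha : 0 < a) (hb : 0 < b) (hc : 0 < c)
    (ha1 : a ≤ 1) (hb1 : b ≤ 1) (hc1 : c ≤ 1) :
    ∃ x₀ y₀ z₀ : ℝ, 0 < x₀ ∧ 0 < y₀ ∧ 0 < z₀ ∧ x₀ + y₀ + z₀ = 1 ∧
      ∀ x y z : ℕ → ℝ, x 0 = x₀ → y 0 = y₀ → z 0 = z₀ →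
        (∀ n, x (n + 1) = x n * (1 + a * y n - b * z n)) →
        (∀ n, y (n + 1) = y n * (1 - a * x n + c * z n)) →
        (∀ n, z (n + 1) = z n * (1 + b * x n - c * y n)) →
        ∀ L M N : ℝ, HasMean x L → HasMean y M → HasMean z N → False := by
  set K := c * Real.log (c / (a + b + c)) + b * Real.log (b / (a + b + c)) +
        a * Real.log (a / (a + b + c)) with hK
  set ε := Real.exp (-(|K| / c + 1)) with hε
  have hε0 : 0 < ε := Real.exp_pos _
  have hε1 : ε < 1 := Real.exp_lt_one_iff.2 (neg_lt_zero.2 (by positivity))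
  refine ⟨ε, (1 - ε) / 2, (1 - ε) / 2, hε0, by linarith, by linarith, by ring, ?_⟩
  intro x y z hx0 hy0 hz0 hx hy hz L M N hL hM hN
  have hpos : ∀ n, 0 < x n ∧ 0 < y n ∧ 0 < z n ∧ x n + y n + z n = 1 := by
    intro n
    induction n with
    | zero =>
      rw [hx0, hy0, hz0]
      exact ⟨hε0, by linarith, by linarith, by ring⟩
    | succ n ih =>
      obtain ⟨h1, h2, h3, h4⟩ := ih
      rw [hx, hy, hz]
      refine ⟨mul_pos h1 ?_, mul_pos h2 ?_, mul_pos h3 ?_, by linear_combination h4⟩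
      · nlinarith [mul_pos ha h2]
      · nlinarith [mul_pos hc h3]
      · nlinarith [mul_pos hb h1]
  have horb : IsInteriorOrbit a b c x y z :=
    ⟨ha, hb, hc, ha1, hb1, hc1, fun n => (hpos n).1, fun n => (hpos n).2.1,
      fun n => (hpos n).2.2.1, fun n => (hpos n).2.2.2, hx, hy, hz⟩
  refine horb.not_hasMean (horb.eventually_le_of_lyapunov_lt ?_) hL hM hN
  rw [← hK, hx0, hy0, hz0, hε, Real.log_exp, ← hε]
  have hlog : Real.log ((1 - ε) / 2) ≤ 0 := Real.log_nonpos (by linarith) (by linarith)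
  have h1 := mul_nonpos_of_nonneg_of_nonpos ha.le hlog
  have h2 := mul_nonpos_of_nonneg_of_nonpos hb.le hlog
  have h3 : c * -(|K| / c + 1) = -|K| - c := by
    field_simp
    ring
  linarith [neg_abs_le K]

theorem volterra_mapsTo_simplex2 {a b c : ℝ} (ha : a ∈ Set.Icc (-1 : ℝ) 1)
    (hb : b ∈ Set.Icc (-1 : ℝ) 1) (hc : c ∈ Set.Icc (-1 : ℝ) 1) :
    Set.MapsTo (volterra a b c) simplex2 simplex2 := by
  rintro ⟨x, y, z⟩ ⟨hx, hy, hz, hs⟩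
  obtain ⟨ha0, ha1⟩ := ha
  obtain ⟨hb0, hb1⟩ := hb
  obtain ⟨hc0, hc1⟩ := hc
  dsimp only at hx hy hz hs
  refine ⟨mul_nonneg hx ?_, mul_nonneg hy ?_, mul_nonneg hz ?_, ?_⟩ <;>
    dsimp only [volterra]
  · nlinarith
  · nlinarith
  · nlinarith
  · linear_combination hs

open Topology in
/-- A sequence in the simplex converges as soon as two of its coordinates converge. -/
theorem tendsto_of_mem_simplex2 {w : ℕ → ℝ × ℝ × ℝ} (hw : ∀ n, w n ∈ simplex2)
    {l : ℝ} {m : ℝ} (h : (Tendsto (fun n => (w n).1) atTop (𝓝 l) ∧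
        Tendsto (fun n => (w n).2.1) atTop (𝓝 m)) ∨
      (Tendsto (fun n => (w n).2.1) atTop (𝓝 l) ∧ Tendsto (fun n => (w n).2.2) atTop (𝓝 m)) ∨
      (Tendsto (fun n => (w n).2.2) atTop (𝓝 l) ∧ Tendsto (fun n => (w n).1) atTop (𝓝 m))) :
    ∃ L, Tendsto w atTop (𝓝 L) := by
  rcases h with ⟨h1, h2⟩ | ⟨h1, h2⟩ | ⟨h1, h2⟩
  · exact ⟨_, h1.prodMk_nhds (h2.prodMk_nhds (((h1.const_sub 1).sub h2).congr fun n => by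
      linarith [(hw n).2.2.2]))⟩
  · exact ⟨_, Tendsto.prodMk_nhds (((h1.const_sub 1).sub h2).congr fun n => by
      linarith [(hw n).2.2.2]) (h1.prodMk_nhds h2)⟩
  · exact ⟨_, h2.prodMk_nhds (Tendsto.prodMk_nhds (((h1.const_sub 1).sub h2).congr fun n => by
      linarith [(hw n).2.2.2]) h1)⟩

open Topology in
/-- If `a, b, c` do not have the same strict sign, then one coordinate is nondecreasing and another
one is nonincreasing along every orbit, so that the orbit converges. -/
theorem exists_tendsto_iterate_volterra {a b c : ℝ} (ha : a ∈ Set.Icc (-1 : ℝ) 1)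
    (hb : b ∈ Set.Icc (-1 : ℝ) 1) (hc : c ∈ Set.Icc (-1 : ℝ) 1)
    (habc : ¬ ((0 < a ∧ 0 < b ∧ 0 < c) ∨ (a < 0 ∧ b < 0 ∧ c < 0)))
    {w : ℝ × ℝ × ℝ} (hw : w ∈ simplex2) :
    ∃ L, Tendsto (fun n => (volterra a b c)^[n] w) atTop (𝓝 L) := by
  set v : ℕ → ℝ × ℝ × ℝ := fun n => (volterra a b c)^[n] w with hv
  have hmem : ∀ n, v n ∈ simplex2 := fun n => (volterra_mapsTo_simplex2 ha hb hc).iterate n hw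
  have hsucc : ∀ n, v (n + 1) = volterra a b c (v n) := fun n =>
    Function.iterate_succ_apply' _ _ _
  have hlim : ∀ u : ℕ → ℝ, (∀ n, 0 ≤ u n ∧ u n ≤ 1) →
      ((∀ n, u n ≤ u (n + 1)) ∨ ∀ n, u (n + 1) ≤ u n) → ∃ l, Tendsto u atTop (𝓝 l) := by
    rintro u hu (h | h)
    · exact ⟨_, tendsto_atTop_ciSup (monotone_nat_of_le_succ h)
        ⟨1, by rintro _ ⟨n, rfl⟩; exact (hu n).2⟩⟩
    · exact ⟨_, tendsto_atTop_ciInf (antitone_nat_of_succ_le h)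
        ⟨0, by rintro _ ⟨n, rfl⟩; exact (hu n).1⟩⟩
  have hx : (0 ≤ a ∧ b ≤ 0 ∨ a ≤ 0 ∧ 0 ≤ b) → ∃ l, Tendsto (fun n => (v n).1) atTop (𝓝 l) := by
    intro h
    refine hlim _ (fun n => ?_) (h.imp (fun h n => ?_) fun h n => ?_)
    · obtain ⟨h1, h2, h3, h4⟩ := hmem n
      exact ⟨h1, by linarith⟩
    · obtain ⟨h1, h2, h3, h4⟩ := hmem n
      rw [hsucc]
      exact le_mul_of_one_le_right h1 (by nlinarith [mul_nonneg h.1 h2])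
    · obtain ⟨h1, h2, h3, h4⟩ := hmem n
      rw [hsucc]
      exact mul_le_of_le_one_right h1 (by nlinarith [mul_nonneg h.2 h3])
  have hy : (a ≤ 0 ∧ 0 ≤ c ∨ 0 ≤ a ∧ c ≤ 0) → ∃ l, Tendsto (fun n => (v n).2.1) atTop (𝓝 l) := by
    intro h
    refine hlim _ (fun n => ?_) (h.imp (fun h n => ?_) fun h n => ?_)
    · obtain ⟨h1, h2, h3, h4⟩ := hmem n
      exact ⟨h2, by linarith⟩
    · obtain ⟨h1, h2, h3, h4⟩ := hmem n
      rw [hsucc]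
      exact le_mul_of_one_le_right h2 (by nlinarith [mul_nonneg h.2 h3])
    · obtain ⟨h1, h2, h3, h4⟩ := hmem n
      rw [hsucc]
      exact mul_le_of_le_one_right h2 (by nlinarith [mul_nonneg h.1 h1])
  have hz : (0 ≤ b ∧ c ≤ 0 ∨ b ≤ 0 ∧ 0 ≤ c) → ∃ l, Tendsto (fun n => (v n).2.2) atTop (𝓝 l) := by
    intro h
    refine hlim _ (fun n => ?_) (h.imp (fun h n => ?_) fun h n => ?_)
    · obtain ⟨h1, h2, h3, h4⟩ := hmem n
      exact ⟨h3, by linarith⟩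
    · obtain ⟨h1, h2, h3, h4⟩ := hmem n
      rw [hsucc]
      exact le_mul_of_one_le_right h3 (by nlinarith [mul_nonneg h.1 h1])
    · obtain ⟨h1, h2, h3, h4⟩ := hmem n
      rw [hsucc]
      exact mul_le_of_le_one_right h3 (by nlinarith [mul_nonneg h.2 h2])
  have hcases : ((0 ≤ a ∧ b ≤ 0 ∨ a ≤ 0 ∧ 0 ≤ b) ∧ (a ≤ 0 ∧ 0 ≤ c ∨ 0 ≤ a ∧ c ≤ 0)) ∨
      ((a ≤ 0 ∧ 0 ≤ c ∨ 0 ≤ a ∧ c ≤ 0) ∧ (0 ≤ b ∧ c ≤ 0 ∨ b ≤ 0 ∧ 0 ≤ c)) ∨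
      ((0 ≤ b ∧ c ≤ 0 ∨ b ≤ 0 ∧ 0 ≤ c) ∧ (0 ≤ a ∧ b ≤ 0 ∨ a ≤ 0 ∧ 0 ≤ b)) := by
    clear hx hy hz hlim hsucc hmem hv ha hb hc hw
    grind
  rcases hcases with ⟨h1, h2⟩ | ⟨h1, h2⟩ | ⟨h1, h2⟩
  · obtain ⟨l, hl⟩ := hx h1
    obtain ⟨m, hm⟩ := hy h2
    exact tendsto_of_mem_simplex2 hmem (Or.inl ⟨hl, hm⟩)
  · obtain ⟨l, hl⟩ := hy h1
    obtain ⟨m, hm⟩ := hz h2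
    exact tendsto_of_mem_simplex2 hmem (Or.inr (Or.inl ⟨hl, hm⟩))
  · obtain ⟨l, hl⟩ := hz h1
    obtain ⟨m, hm⟩ := hx h2
    exact tendsto_of_mem_simplex2 hmem (Or.inr (Or.inr ⟨hl, hm⟩))

open Topology in
theorem hasMean_of_tendsto_cesaro {w : ℕ → ℝ × ℝ × ℝ} {L : ℝ × ℝ × ℝ}
    (h : Tendsto (fun k : ℕ => (k : ℝ)⁻¹ • ∑ i ∈ Finset.range k, w i) atTop (𝓝 L)) :
    HasMean (fun n => (w n).1) L.1 ∧ HasMean (fun n => (w n).2.1) L.2.1 ∧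
      HasMean (fun n => (w n).2.2) L.2.2 := by
  refine ⟨h.fst_nhds.congr fun n => ?_, h.snd_nhds.fst_nhds.congr fun n => ?_,
    h.snd_nhds.snd_nhds.congr fun n => ?_⟩ <;> simp [Prod.fst_sum, Prod.snd_sum]

/-- The Volterra quadratic stochastic operator with parameters `a, b, c ∈ [−1, 1]` is
non-ergodic — i.e. there is an initial point `w ∈ S²` whose Cesàro averages
`(1/k)·∑_{i<k} V^i w` do not converge — if and only if `a, b, c` all have the same
sign (all positive or all negative). -/
theorem volterra_nonergodic_iff (a b c : ℝ)
    (ha : a ∈ Set.Icc (-1 : ℝ) 1) (hb : b ∈ Set.Icc (-1 : ℝ) 1)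
    (hc : c ∈ Set.Icc (-1 : ℝ) 1) :
    (∃ w ∈ simplex2, ¬ ∃ L : ℝ × ℝ × ℝ,
        Tendsto (fun k : ℕ => (k : ℝ)⁻¹ • ∑ i ∈ Finset.range k, (volterra a b c)^[i] w)
          atTop (nhds L)) ↔
      ((0 < a ∧ 0 < b ∧ 0 < c) ∨ (a < 0 ∧ b < 0 ∧ c < 0)) := by
  constructor
  · rintro ⟨w, hw, hL⟩
    by_contra habc
    obtain ⟨L, hlim⟩ := exists_tendsto_iterate_volterra ha hb hc habc hw
    exact hL ⟨L, hlim.cesaro_smul⟩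
  · rintro (⟨ha0, hb0, hc0⟩ | ⟨ha0, hb0, hc0⟩)
    · obtain ⟨x, y, z, hx, hy, hz, hs, H⟩ :=
        exists_start_not_hasMean ha0 hb0 hc0 ha.2 hb.2 hc.2
      refine ⟨(x, y, z), ⟨hx.le, hy.le, hz.le, hs⟩, ?_⟩
      rintro ⟨L, hL⟩
      obtain ⟨h1, h2, h3⟩ := hasMean_of_tendsto_cesaro hL
      refine H _ _ _ rfl rfl rfl (fun n => ?_) (fun n => ?_) (fun n => ?_) _ _ _ h1 h2 h3 <;>
        rw [Function.iterate_succ_apply'] <;> rfl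
    · -- Exchanging the first two coordinates conjugates `V` to the operator with parameters
      -- `-a, -c, -b`.
      obtain ⟨x, y, z, hx, hy, hz, hs, H⟩ :=
        exists_start_not_hasMean (neg_pos.2 ha0) (neg_pos.2 hc0) (neg_pos.2 hb0)
          (by linarith [ha.1]) (by linarith [hc.1]) (by linarith [hb.1])
      refine ⟨(y, x, z), ⟨hy.le, hx.le, hz.le, by linarith⟩, ?_⟩
      rintro ⟨L, hL⟩
      obtain ⟨h1, h2, h3⟩ := hasMean_of_tendsto_cesaro hL
      refine H _ _ _ rfl rfl rfl (fun n => ?_) (fun n => ?_) (fun n => ?_) _ _ _ h2 h1 h3 <;>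
        rw [Function.iterate_succ_apply'] <;> simp only [volterra] <;> ring
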